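/- ζ(5) = (2/15) · π² · ζ(3) + (16/15) · π⁴ · ( -log 2 / 120 + Σ_{n=1}^{∞} (2 - 2^{1-2n}) · Γ(2n) · ζ(2n) / Γ(2n + 6) ), where the series converges. -/

import Mathlib

open Complex Real
open MeasureTheory intervalIntegral Filter Topology

/-- The real Dirichlet series `∑ 1 / (j + 1) ^ k`, which is `ζ(k)` for `k ≥ 2`. -/
noncomputable def realZeta (k : ℕ) : ℝ := ∑' j : ℕ, 1 / ((j : ℝ) + 1) ^ k

lemma hasSum_realZeta {k : ℕ} (hk : 1 < k) :
    HasSum (fun j : ℕ => 1 / ((j : ℝ) + 1) ^ k) (realZeta k) := by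
  have h := (summable_nat_add_iff 1).2 (Real.summable_one_div_nat_pow.2 hk)
  simpa [realZeta] using h.hasSum

lemma riemannZeta_natCast_eq_realZeta {k : ℕ} (hk : 1 < k) :
    riemannZeta k = (realZeta k : ℂ) := by
  rw [zeta_eq_tsum_one_div_nat_add_one_cpow (by simpa using hk), realZeta, Complex.ofReal_tsum]
  congr 1
  ext j
  push_cast
  rw [Complex.cpow_natCast]

lemma hasSum_alternating_realZeta {k : ℕ} (hk : 1 < k) :
    HasSum (fun j : ℕ => (-1 : ℝ) ^ (j + 1) / ((j : ℝ) + 1) ^ k)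
      ((2 / 2 ^ k - 1) * realZeta k) := by
  have hZ := hasSum_realZeta hk
  have hodd : HasSum (fun j : ℕ => 1 / (((2 * j + 1 : ℕ) : ℝ) + 1) ^ k) (realZeta k / 2 ^ k) := by
    convert! hZ.div_const (2 ^ k) using 2 with j
    rw [div_div, ← mul_pow]
    push_cast
    ring_nf
  have heven : Summable (fun j : ℕ => 1 / (((2 * j : ℕ) : ℝ) + 1) ^ k) :=
    hZ.summable.comp_injective (i := fun j : ℕ => 2 * j) (fun a b h => by simpa using h)
  have hsum := hZ.unique
    (HasSum.even_add_odd (f := fun j : ℕ => 1 / ((j : ℝ) + 1) ^ k) heven.hasSum hodd)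
  have h := HasSum.even_add_odd (f := fun j : ℕ => (-1 : ℝ) ^ (j + 1) / ((j : ℝ) + 1) ^ k)
    (m := -∑' j : ℕ, 1 / (((2 * j : ℕ) : ℝ) + 1) ^ k) (m' := realZeta k / 2 ^ k)
    (by
      convert! heven.hasSum.neg using 2 with j
      rw [pow_succ, pow_mul]
      simp [neg_div])
    (by
      convert! hodd using 2 with j
      rw [pow_succ, pow_succ, pow_mul]
      simp)
  convert! h using 1
  linear_combination -hsum

lemma hasSum_neg_log_sin_div {x : ℝ} (hx0 : 0 < x) (hx1 : x < 1) :
    HasSum (fun n : ℕ => realZeta (2 * (n + 1)) * x ^ (2 * (n + 1)) / ((n : ℝ) + 1))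
      (-Real.log (Real.sin (π * x) / (π * x))) := by
  have hsq (j : ℕ) : x ^ 2 / ((j : ℝ) + 1) ^ 2 < 1 := by
    rw [← div_pow]
    refine pow_lt_one₀ (by positivity) ?_ two_ne_zero
    rw [div_lt_one (by positivity)]
    linarith [(Nat.cast_nonneg j : (0 : ℝ) ≤ j)]
  have hsq0 (j : ℕ) : 0 ≤ x ^ 2 / ((j : ℝ) + 1) ^ 2 := by positivity
  have hsin : 0 < Real.sin (π * x) :=
    Real.sin_pos_of_pos_of_lt_pi (by positivity) (by nlinarith [Real.pi_pos])
  have houter : HasSum (fun j : ℕ => -Real.log (1 - x ^ 2 / ((j : ℝ) + 1) ^ 2))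
      (-Real.log (Real.sin (π * x) / (π * x))) := by
    rw [hasSum_iff_tendsto_nat_of_nonneg]
    · have h := (Real.tendsto_euler_sin_prod x).div_const (π * x)
      have h2 := (h.log (by positivity)).neg
      refine h2.congr fun n => ?_
      rw [mul_div_cancel_left₀ _ (by positivity), Real.log_prod, Finset.sum_neg_distrib]
      intro j _
      exact (sub_pos.2 (hsq j)).ne'
    · intro j
      exact neg_nonneg.2 (Real.log_nonpos (by linarith [hsq j]) (by linarith [hsq0 j]))
  have hinner (j : ℕ) : HasSum
      (fun n : ℕ => (x ^ 2 / ((j : ℝ) + 1) ^ 2) ^ (n + 1) / ((n : ℝ) + 1))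
      (-Real.log (1 - x ^ 2 / ((j : ℝ) + 1) ^ 2)) :=
    Real.hasSum_pow_div_log_of_abs_lt_one (by rw [abs_of_nonneg (hsq0 j)]; exact hsq j)
  have hprod : Summable (fun p : ℕ × ℕ =>
      (x ^ 2 / ((p.1 : ℝ) + 1) ^ 2) ^ (p.2 + 1) / ((p.2 : ℝ) + 1)) := by
    rw [summable_prod_of_nonneg (fun p => by positivity)]
    refine ⟨fun j => (hinner j).summable, ?_⟩
    simpa only [(hinner _).tsum_eq] using houter.summable
  have htotal := hprod.hasSum
  rw [← houter.unique (htotal.prod_fiberwise hinner)] at htotal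
  refine ((Equiv.prodComm ℕ ℕ).hasSum_iff.2 htotal).prod_fiberwise fun n => ?_
  have h := ((hasSum_realZeta (k := 2 * (n + 1)) (by lia)).mul_right
    (x ^ (2 * (n + 1)) / ((n : ℝ) + 1)))
  convert! h using 1
  · ext j
    simp only [Function.comp, Equiv.prodComm_apply, Prod.swap]
    rw [div_pow, ← pow_mul, ← pow_mul]
    field_simp
  · ring

lemma hasSum_neg_log_cos {x : ℝ} (hx0 : 0 < x) (hx1 : x < 1) :
    HasSum (fun n : ℕ =>
        realZeta (2 * (n + 1)) * (1 - 1 / 4 ^ (n + 1)) * x ^ (2 * (n + 1)) / ((n : ℝ) + 1))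
      (-Real.log (Real.cos (π * x / 2))) := by
  have h := (hasSum_neg_log_sin_div hx0 hx1).sub
    (hasSum_neg_log_sin_div (x := x / 2) (by linarith) (by linarith))
  have hpi := Real.pi_pos
  have hsin : 0 < Real.sin (π * x / 2) :=
    Real.sin_pos_of_pos_of_lt_pi (by positivity) (by nlinarith)
  have hcos : 0 < Real.cos (π * x / 2) :=
    Real.cos_pos_of_mem_Ioo ⟨by nlinarith, by nlinarith⟩
  convert! h using 1
  · ext n
    rw [div_pow, pow_mul 2 2]
    norm_num
    ring
  · have key : Real.sin (π * x) / (π * x) =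
        Real.cos (π * x / 2) * (Real.sin (π * (x / 2)) / (π * (x / 2))) := by
      rw [show π * x = 2 * (π * x / 2) by ring, Real.sin_two_mul,
        show π * (x / 2) = π * x / 2 by ring]
      field_simp
    rw [show π * (x / 2) = π * x / 2 by ring] at key ⊢
    rw [key, Real.log_mul hcos.ne' (by positivity)]
    ring

lemma integral_one_sub_pow_four_mul_pow (m : ℕ) :
    ∫ x in (0 : ℝ)..1, (1 - x) ^ 4 * x ^ m =
      24 / (((m : ℝ) + 1) * (m + 2) * (m + 3) * (m + 4) * (m + 5)) := by
  have hderiv (c : ℕ) (x : ℝ) : HasDerivAt (fun y : ℝ => y ^ (m + c + 1) / ((m : ℝ) + c + 1))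
      (x ^ (m + c)) x := by
    have h := (hasDerivAt_pow (m + c + 1) x).div_const ((m : ℝ) + c + 1)
    refine h.congr_deriv ?_
    push_cast
    field_simp
  rw [intervalIntegral.integral_eq_sub_of_hasDerivAt
    (fun x _ => (((((hderiv 0 x).sub ((hderiv 1 x).const_mul 4)).add
      ((hderiv 2 x).const_mul 6)).sub ((hderiv 3 x).const_mul 4)).add (hderiv 4 x)).congr_deriv
        (by ring))
    (Continuous.intervalIntegrable (by fun_prop) _ _)]
  simp
  field_simp
  ring

lemma integral_pow_four_mul_cos (k : ℕ) :
    ∫ y in (0 : ℝ)..1, y ^ 4 * Real.cos (((k : ℝ) + 1) * (π * y)) =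
      (-1) ^ (k + 1) *
        (4 / (((k : ℝ) + 1) ^ 2 * π ^ 2) - 24 / (((k : ℝ) + 1) ^ 4 * π ^ 4)) := by
  set a : ℝ := ((k : ℝ) + 1) * π with ha
  have ha0 : a ≠ 0 := by positivity
  have hsin : Real.sin a = 0 := by
    rw [ha]; exact_mod_cast Real.sin_nat_mul_pi (k + 1)
  have hcos : Real.cos a = (-1) ^ (k + 1) := by
    rw [ha]; exact_mod_cast Real.cos_nat_mul_pi (k + 1)
  have hs (y : ℝ) : HasDerivAt (fun y => Real.sin (a * y)) (Real.cos (a * y) * a) y := by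
    simpa using ((hasDerivAt_id y).const_mul a).sin
  have hc (y : ℝ) : HasDerivAt (fun y => Real.cos (a * y)) (-Real.sin (a * y) * a) y := by
    simpa using ((hasDerivAt_id y).const_mul a).cos
  have hp (n : ℕ) (y : ℝ) := hasDerivAt_pow (𝕜 := ℝ) n y
  have hd (y : ℝ) : HasDerivAt (fun y : ℝ => y ^ 4 * Real.sin (a * y) / a +
      4 * (y ^ 3 * Real.cos (a * y)) / a ^ 2 - 12 * (y ^ 2 * Real.sin (a * y)) / a ^ 3
      - 24 * (y ^ 1 * Real.cos (a * y)) / a ^ 4 + 24 * Real.sin (a * y) / a ^ 5)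
      (y ^ 4 * Real.cos (((k : ℝ) + 1) * (π * y))) y := by
    refine HasDerivAt.congr_deriv
      ((((((hp 4 y).mul (hs y)).div_const a).add
        ((((hp 3 y).mul (hc y)).const_mul 4).div_const (a ^ 2))).sub
        ((((hp 2 y).mul (hs y)).const_mul 12).div_const (a ^ 3))).sub
        ((((hp 1 y).mul (hc y)).const_mul 24).div_const (a ^ 4)) |>.add
        (((hs y).const_mul 24).div_const (a ^ 5))) ?_
    rw [show ((k : ℝ) + 1) * (π * y) = a * y by rw [ha]; ring]
    field_simp
    push_cast
    ring
  rw [intervalIntegral.integral_eq_sub_of_hasDerivAt (fun y _ => hd y)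
    (Continuous.intervalIntegrable (by fun_prop) _ _)]
  rw [← mul_pow, ← mul_pow, ← ha, ← hcos]
  simp [hsin]
  ring

lemma hasSum_pow_mul_cos_div {r : ℝ} (hr0 : 0 ≤ r) (hr1 : r < 1) (θ : ℝ) :
    HasSum (fun k : ℕ => r ^ (k + 1) / ((k : ℝ) + 1) * Real.cos (((k : ℝ) + 1) * θ))
      (-(Real.log (1 - 2 * r * Real.cos θ + r ^ 2) / 2)) := by
  set z : ℂ := r * Complex.exp (θ * I) with hz
  have hnorm : ‖z‖ < 1 := by
    rw [hz, norm_mul, Complex.norm_exp_ofReal_mul_I, Complex.norm_real, Real.norm_eq_abs,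
      abs_of_nonneg hr0, mul_one]
    exact hr1
  have h := Complex.hasSum_re
    ((hasSum_nat_add_iff' 1).2 (Complex.hasSum_taylorSeries_neg_log hnorm))
  convert! h using 1
  · ext k
    rw [hz, mul_pow, ← Complex.exp_nat_mul, ← mul_assoc]
    have : ((k + 1 : ℕ) : ℂ) * θ = ((((k : ℝ) + 1) * θ : ℝ) : ℂ) := by push_cast; ring
    rw [this, mul_div_right_comm,
      show (r : ℂ) ^ (k + 1) / ((k + 1 : ℕ) : ℂ) = ((r ^ (k + 1) / ((k : ℝ) + 1) : ℝ) : ℂ) by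
        push_cast; ring, Complex.re_ofReal_mul, Complex.exp_ofReal_mul_I_re]
  · have hsq : 1 - 2 * r * Real.cos θ + r ^ 2 = ‖1 - z‖ ^ 2 := by
      rw [Complex.sq_norm, Complex.normSq_apply, hz]
      simp [Complex.exp_ofReal_mul_I_re, Complex.exp_ofReal_mul_I_im]
      nlinarith [Real.sin_sq_add_cos_sq θ]
    rw [hsq, Real.log_pow]
    simp [Complex.log_re]

lemma two_mul_sin_sq_le {r : ℝ} (hr : 1 / 2 ≤ r) (t : ℝ) :
    2 * Real.sin (t / 2) ^ 2 ≤ 1 - 2 * r * Real.cos t + r ^ 2 := by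
  have h : Real.cos t = 1 - 2 * Real.sin (t / 2) ^ 2 := by
    have h := Real.cos_two_mul (t / 2)
    rw [mul_div_cancel₀ t two_ne_zero] at h
    linarith [Real.sin_sq_add_cos_sq (t / 2)]
  rw [h]
  nlinarith [sq_nonneg (1 - r), sq_nonneg (Real.sin (t / 2))]

lemma sin_half_pi_mul_pos {y : ℝ} (hy : y ∈ Set.Ioc (0 : ℝ) 1) : 0 < Real.sin (π * y / 2) :=
  Real.sin_pos_of_pos_of_lt_pi (by have := hy.1; positivity)
    (by nlinarith [Real.pi_pos, hy.1, hy.2])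

lemma intervalIntegrable_log_sin_half_pi_mul :
    IntervalIntegrable (fun y => Real.log (Real.sin (π * y / 2))) volume 0 1 := by
  have h := (intervalIntegrable_log_sin (a := 0) (b := π / 2)).comp_mul_left (c := π / 2)
  rw [zero_div, div_self (by positivity)] at h
  refine h.congr ?_
  intro y _
  simp only [Function.comp]
  ring_nf

lemma hasSum_integral_pow_four_mul_log {r : ℝ} (hr0 : 0 ≤ r) (hr1 : r < 1) :
    HasSum (fun k : ℕ => r ^ (k + 1) / ((k : ℝ) + 1) *
        ∫ y in (0 : ℝ)..1, y ^ 4 * Real.cos (((k : ℝ) + 1) * (π * y)))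
      (∫ y in (0 : ℝ)..1, y ^ 4 * -(Real.log (1 - 2 * r * Real.cos (π * y) + r ^ 2) / 2)) := by
  have h := intervalIntegral.hasSum_integral_of_dominated_convergence (μ := volume)
    (a := 0) (b := 1) (fun k _ => r ^ k)
    (F := fun (k : ℕ) y => y ^ 4 *
      (r ^ (k + 1) / ((k : ℝ) + 1) * Real.cos (((k : ℝ) + 1) * (π * y))))
    (f := fun y => y ^ 4 * -(Real.log (1 - 2 * r * Real.cos (π * y) + r ^ 2) / 2))
    (fun k => Continuous.aestronglyMeasurable (by fun_prop))
    (fun k => ae_of_all _ fun y hy => ?_)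
    (ae_of_all _ fun _ _ => summable_geometric_of_lt_one hr0 hr1)
    intervalIntegrable_const
    (ae_of_all _ fun y _ => (hasSum_pow_mul_cos_div hr0 hr1 (π * y)).mul_left (y ^ 4))
  · convert! h using 2 with k
    rw [← intervalIntegral.integral_const_mul]
    congr 1
    ext y
    ring
  · rw [Set.uIoc_of_le zero_le_one] at hy
    rw [norm_mul, norm_mul, Real.norm_eq_abs, Real.norm_eq_abs, Real.norm_eq_abs,
      abs_of_nonneg (pow_nonneg hy.1.le 4), abs_of_nonneg (by positivity)]
    have h1 : y ^ 4 ≤ 1 := pow_le_one₀ hy.1.le hy.2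
    have h2 : r ^ (k + 1) / ((k : ℝ) + 1) ≤ r ^ k :=
      (div_le_self (by positivity) (by simp)).trans
        (pow_le_pow_of_le_one hr0 hr1.le (Nat.le_succ k))
    have h3 := Real.abs_cos_le_one (((k : ℝ) + 1) * (π * y))
    calc _ ≤ 1 * (r ^ k * 1) := by gcongr
      _ = r ^ k := by ring

lemma tendsto_integral_pow_four_mul_log :
    Tendsto (fun r : ℝ => ∫ y in (0 : ℝ)..1,
        y ^ 4 * -(Real.log (1 - 2 * r * Real.cos (π * y) + r ^ 2) / 2)) (𝓝[<] 1)
      (𝓝 (∫ y in (0 : ℝ)..1, y ^ 4 * -(Real.log 2 + Real.log (Real.sin (π * y / 2))))) := by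
  have hev : ∀ᶠ r : ℝ in 𝓝[<] 1, r ∈ Set.Ioo (1 / 2 : ℝ) 1 :=
    Ioo_mem_nhdsLT (by norm_num)
  refine intervalIntegral.tendsto_integral_filter_of_dominated_convergence
    (fun y => (|Real.log 2 + 2 * Real.log (Real.sin (π * y / 2))| + Real.log 4) / 2)
    (Eventually.of_forall fun r => Measurable.aestronglyMeasurable (by fun_prop))
    ?_ ?_ (ae_of_all _ fun y hy => ?_)
  · filter_upwards [hev] with r hr
    refine ae_of_all _ fun y hy => ?_
    rw [Set.uIoc_of_le zero_le_one] at hy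
    have hs := sin_half_pi_mul_pos hy
    have hlow := two_mul_sin_sq_le hr.1.le (π * y)
    have hpos : 0 < 1 - 2 * r * Real.cos (π * y) + r ^ 2 := lt_of_lt_of_le (by positivity) hlow
    have hup : 1 - 2 * r * Real.cos (π * y) + r ^ 2 ≤ 4 := by
      nlinarith [Real.neg_one_le_cos (π * y), hr.1, hr.2]
    have hlog1 := Real.log_le_log (by positivity) hlow
    have hlog2 := Real.log_le_log hpos hup
    rw [Real.log_mul (by norm_num) (by positivity), Real.log_pow] at hlog1
    push_cast at hlog1
    have h4 : 0 ≤ Real.log 4 := Real.log_nonneg (by norm_num)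
    have habs : |Real.log (1 - 2 * r * Real.cos (π * y) + r ^ 2)| ≤
        |Real.log 2 + 2 * Real.log (Real.sin (π * y / 2))| + Real.log 4 := by
      rw [abs_le]
      constructor
      · linarith [neg_abs_le (Real.log 2 + 2 * Real.log (Real.sin (π * y / 2)))]
      · linarith [abs_nonneg (Real.log 2 + 2 * Real.log (Real.sin (π * y / 2)))]
    rw [norm_mul, norm_neg, norm_div, Real.norm_eq_abs, Real.norm_eq_abs,
      abs_of_nonneg (pow_nonneg hy.1.le 4), Real.norm_two]
    calc _ ≤ 1 * ((|Real.log 2 + 2 * Real.log (Real.sin (π * y / 2))| + Real.log 4) / 2) := by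
          gcongr
          exact pow_le_one₀ hy.1.le hy.2
      _ = _ := one_mul _
  · exact (((intervalIntegrable_const.add
      (intervalIntegrable_log_sin_half_pi_mul.const_mul 2)).abs).add
        intervalIntegrable_const).div_const 2
  · rw [Set.uIoc_of_le zero_le_one] at hy
    have hs := sin_half_pi_mul_pos hy
    have hval : 1 - 2 * 1 * Real.cos (π * y) + 1 ^ 2 = (2 * Real.sin (π * y / 2)) ^ 2 := by
      rw [show π * y = 2 * (π * y / 2) by ring, Real.cos_two_mul]
      rw [show 2 * (π * y / 2) / 2 = π * y / 2 by ring]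
      linarith [Real.sin_sq_add_cos_sq (π * y / 2)]
    have hlim : Real.log 2 + Real.log (Real.sin (π * y / 2)) =
        Real.log (1 - 2 * 1 * Real.cos (π * y) + 1 ^ 2) / 2 := by
      rw [hval, Real.log_pow, Real.log_mul two_ne_zero hs.ne']
      push_cast
      ring
    rw [hlim]
    refine Tendsto.mono_left ?_ nhdsWithin_le_nhds
    have hcont : ContinuousAt (fun r : ℝ => 1 - 2 * r * Real.cos (π * y) + r ^ 2) 1 := by
      fun_prop
    exact ((hcont.log (by rw [hval]; positivity)).div_const 2).neg.const_mul (y ^ 4)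

lemma hasSum_integral_coeff :
    HasSum (fun k : ℕ => 1 / ((k : ℝ) + 1) *
        ∫ y in (0 : ℝ)..1, y ^ 4 * Real.cos (((k : ℝ) + 1) * (π * y)))
      (15 / 16 * (24 / π ^ 4) * realZeta 5 - 3 / 4 * (4 / π ^ 2) * realZeta 3) := by
  have h := ((hasSum_alternating_realZeta (k := 3) (by norm_num)).mul_left (4 / π ^ 2)).sub
    ((hasSum_alternating_realZeta (k := 5) (by norm_num)).mul_left (24 / π ^ 4))
  convert! h using 1
  · ext k
    rw [integral_pow_four_mul_cos]
    field_simp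
  · ring

lemma integral_pow_four_mul_log_sin :
    ∫ y in (0 : ℝ)..1, y ^ 4 * -Real.log (Real.sin (π * y / 2)) =
      Real.log 2 / 5 + 15 / 16 * (24 / π ^ 4) * realZeta 5 - 3 / 4 * (4 / π ^ 2) * realZeta 3 := by
  have hev : ∀ᶠ r : ℝ in 𝓝[<] 1, r ∈ Set.Ioo (1 / 2 : ℝ) 1 :=
    Ioo_mem_nhdsLT (by norm_num)
  have hlim : Tendsto (fun r : ℝ => ∑' k : ℕ, r ^ (k + 1) / ((k : ℝ) + 1) *
        ∫ y in (0 : ℝ)..1, y ^ 4 * Real.cos (((k : ℝ) + 1) * (π * y))) (𝓝[<] 1)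
      (𝓝 (∑' k : ℕ, 1 / ((k : ℝ) + 1) *
        ∫ y in (0 : ℝ)..1, y ^ 4 * Real.cos (((k : ℝ) + 1) * (π * y)))) := by
    refine tendsto_tsum_of_dominated_convergence hasSum_integral_coeff.summable.norm
      (fun k => ?_) ?_
    · refine Tendsto.mono_left ?_ nhdsWithin_le_nhds
      have hcont : ContinuousAt (fun r : ℝ => r ^ (k + 1) / ((k : ℝ) + 1) *
        ∫ y in (0 : ℝ)..1, y ^ 4 * Real.cos (((k : ℝ) + 1) * (π * y))) 1 := by fun_prop
      simpa [ContinuousAt] using hcont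
    · filter_upwards [hev] with r hr k
      have hr0 : 0 ≤ r := by linarith [hr.1]
      rw [norm_mul, norm_mul]
      gcongr
      rw [Real.norm_of_nonneg (by positivity), Real.norm_of_nonneg (by positivity)]
      gcongr
      exact pow_le_one₀ hr0 hr.2.le
  rw [hasSum_integral_coeff.tsum_eq] at hlim
  have huniq := tendsto_nhds_unique (hlim.congr' (by
    filter_upwards [hev] with r hr
    exact (hasSum_integral_pow_four_mul_log (by linarith [hr.1]) hr.2).tsum_eq))
    tendsto_integral_pow_four_mul_log
  have hint : IntervalIntegrable (fun y => y ^ 4 * -Real.log (Real.sin (π * y / 2)))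
      volume 0 1 :=
    intervalIntegrable_log_sin_half_pi_mul.neg.continuousOn_mul (by fun_prop)
  have hsplit : ∫ y in (0 : ℝ)..1, y ^ 4 * -(Real.log 2 + Real.log (Real.sin (π * y / 2))) =
      (∫ y in (0 : ℝ)..1, y ^ 4 * -Real.log (Real.sin (π * y / 2))) - Real.log 2 / 5 := by
    have hpow : ∫ y in (0 : ℝ)..1, y ^ 4 * Real.log 2 = Real.log 2 / 5 := by
      rw [intervalIntegral.integral_mul_const, integral_pow]
      norm_num
      ring
    rw [← hpow, ← intervalIntegral.integral_sub hint
      (Continuous.intervalIntegrable (by fun_prop) _ _)]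
    congr 1
    ext y
    ring
  linarith

lemma integral_one_sub_pow_four_mul_log_cos :
    ∫ x in (0 : ℝ)..1, (1 - x) ^ 4 * -Real.log (Real.cos (π * x / 2)) =
      ∫ y in (0 : ℝ)..1, y ^ 4 * -Real.log (Real.sin (π * y / 2)) := by
  have h := intervalIntegral.integral_comp_sub_left (a := 0) (b := 1)
    (fun y => y ^ 4 * -Real.log (Real.sin (π * y / 2))) 1
  rw [sub_self, sub_zero] at h
  rw [← h]
  congr 1
  ext x
  rw [← Real.sin_pi_div_two_sub]
  ring_nf

lemma intervalIntegrable_one_sub_pow_four_mul_log_cos :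
    IntervalIntegrable (fun x => (1 - x) ^ 4 * -Real.log (Real.cos (π * x / 2))) volume 0 1 := by
  have h := (intervalIntegrable_log_cos (a := 0) (b := π / 2)).comp_mul_left (c := π / 2)
  rw [zero_div, div_self (by positivity)] at h
  refine IntervalIntegrable.continuousOn_mul (IntervalIntegrable.neg (h.congr ?_)) (by fun_prop)
  intro y _
  simp only [Function.comp]
  ring_nf

lemma hasSum_integral_log_cos :
    HasSum (fun n : ℕ => realZeta (2 * (n + 1)) * (1 - 1 / 4 ^ (n + 1)) / ((n : ℝ) + 1) *
        ∫ x in (0 : ℝ)..1, (1 - x) ^ 4 * x ^ (2 * (n + 1)))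
      (∫ x in (0 : ℝ)..1, (1 - x) ^ 4 * -Real.log (Real.cos (π * x / 2))) := by
  have hone : ∀ᵐ x : ℝ, x ≠ 1 := by simp [ae_iff]
  have hseries {x : ℝ} (hx : x ∈ Set.uIoc 0 1) (hx1 : x ≠ 1) :=
    (hasSum_neg_log_cos (Set.uIoc_of_le (zero_le_one (α := ℝ)) ▸ hx).1
      (lt_of_le_of_ne (Set.uIoc_of_le (zero_le_one (α := ℝ)) ▸ hx).2 hx1)).mul_left ((1 - x) ^ 4)
  have hzeta (n : ℕ) : 0 ≤ realZeta (2 * (n + 1)) := tsum_nonneg fun j => by positivity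
  have hfactor (n : ℕ) : (0 : ℝ) ≤ 1 - 1 / 4 ^ (n + 1) :=
    sub_nonneg.2 (div_le_one_of_le₀ (one_le_pow₀ (by norm_num)) (by positivity))
  have h := intervalIntegral.hasSum_integral_of_dominated_convergence (μ := volume)
    (a := 0) (b := 1)
    (fun (n : ℕ) x => (1 - x) ^ 4 * (realZeta (2 * (n + 1)) * (1 - 1 / 4 ^ (n + 1)) *
      x ^ (2 * (n + 1)) / ((n : ℝ) + 1)))
    (F := fun (n : ℕ) x => (1 - x) ^ 4 * (realZeta (2 * (n + 1)) * (1 - 1 / 4 ^ (n + 1)) *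
      x ^ (2 * (n + 1)) / ((n : ℝ) + 1)))
    (f := fun x => (1 - x) ^ 4 * -Real.log (Real.cos (π * x / 2)))
    (fun n => Continuous.aestronglyMeasurable (by fun_prop))
    (fun n => ae_of_all _ fun x hx => ?_)
    (by filter_upwards [hone] with x hx1 hx using (hseries hx hx1).summable)
    ?_
    (by filter_upwards [hone] with x hx1 hx using hseries hx hx1)
  · convert! h using 2 with n
    rw [← intervalIntegral.integral_const_mul]
    congr 1
    ext x
    ring
  · refine (Real.norm_of_nonneg ?_).le
    have := hzeta n
    have := hfactor n
    have : 0 ≤ x ^ (2 * (n + 1)) := by rw [pow_mul]; positivity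
    positivity
  · refine intervalIntegrable_one_sub_pow_four_mul_log_cos.congr_ae ?_
    rw [EventuallyEq, ae_restrict_iff' measurableSet_uIoc]
    filter_upwards [hone] with x hx1 hx using (hseries hx hx1).tsum_eq.symm

lemma gamma_zeta_term (n : ℕ) :
    (2 - (2 : ℂ) ^ (1 - 2 * ((n : ℤ) + 1))) * Complex.Gamma (2 * ((n : ℂ) + 1)) *
        riemannZeta (2 * ((n : ℂ) + 1)) / Complex.Gamma (2 * ((n : ℂ) + 1) + 6) =
      ((1 / 24 * (realZeta (2 * (n + 1)) * (1 - 1 / 4 ^ (n + 1)) / ((n : ℝ) + 1) *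
        ∫ x in (0 : ℝ)..1, (1 - x) ^ 4 * x ^ (2 * (n + 1))) : ℝ) : ℂ) := by
  obtain ⟨m, hm⟩ : ∃ m : ℕ, m = 2 * (n + 1) := ⟨_, rfl⟩
  have hcast : 2 * ((n : ℂ) + 1) = (m : ℂ) := by rw [hm]; push_cast; ring
  have hm0 : 0 < m := by lia
  have hne (c : ℕ) : (m : ℂ) + c ≠ 0 := by exact_mod_cast (by lia : m + c ≠ 0)
  have h0 : (m : ℂ) ≠ 0 := by exact_mod_cast hm0.ne'
  have h1 : (m : ℂ) + 1 ≠ 0 := by exact_mod_cast hne 1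
  have h2 : (m : ℂ) + 2 ≠ 0 := by exact_mod_cast hne 2
  have h3 : (m : ℂ) + 3 ≠ 0 := by exact_mod_cast hne 3
  have h4 : (m : ℂ) + 4 ≠ 0 := by exact_mod_cast hne 4
  have h5 : (m : ℂ) + 5 ≠ 0 := by exact_mod_cast hne 5
  have hG : Complex.Gamma m ≠ 0 := by
    refine Complex.Gamma_ne_zero_of_re_pos ?_
    simpa using hm0
  have hGamma : Complex.Gamma ((m : ℂ) + 6) =
      (m + 5) * ((m + 4) * ((m + 3) * ((m + 2) * ((m + 1) * (m * Complex.Gamma m))))) := by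
    rw [← Complex.Gamma_add_one _ h0, ← Complex.Gamma_add_one _ h1,
      show (m : ℂ) + 1 + 1 = m + 2 by ring, ← Complex.Gamma_add_one _ h2,
      show (m : ℂ) + 2 + 1 = m + 3 by ring, ← Complex.Gamma_add_one _ h3,
      show (m : ℂ) + 3 + 1 = m + 4 by ring, ← Complex.Gamma_add_one _ h4,
      show (m : ℂ) + 4 + 1 = m + 5 by ring, ← Complex.Gamma_add_one _ h5,
      show (m : ℂ) + 5 + 1 = m + 6 by ring]
  have hpow : (2 : ℂ) ^ (1 - 2 * ((n : ℤ) + 1)) = 2 * (1 / 4 ^ (n + 1)) := by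
    rw [zpow_sub₀ two_ne_zero, zpow_one, zpow_mul]
    norm_cast
    norm_num
    rfl
  have hn : (n : ℂ) + 1 = m / 2 := by rw [← hcast]; ring
  rw [hcast, hGamma, hpow, riemannZeta_natCast_eq_realZeta (by lia),
    integral_one_sub_pow_four_mul_pow, ← hm]
  push_cast
  rw [hn]
  field_simp

/-- `ζ(5) = (2/15) π² ζ(3) + (16/15) π⁴ (-log 2 / 120 +
  Σ_{n=1}^∞ (2 - 2^(1-2n)) Γ(2n) ζ(2n) / Γ(2n+6))`, the series converging. -/
theorem stmt_7 :
    (Summable fun n : ℕ =>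
      (2 - (2 : ℂ) ^ (1 - 2 * ((n : ℤ) + 1))) * Complex.Gamma (2 * ((n : ℂ) + 1)) *
        riemannZeta (2 * ((n : ℂ) + 1)) / Complex.Gamma (2 * ((n : ℂ) + 1) + 6)) ∧
    riemannZeta 5 =
      (2 / 15) * (π : ℂ) ^ 2 * riemannZeta 3 +
        (16 / 15) * (π : ℂ) ^ 4 *
          (-(Real.log 2) / 120 +
            ∑' n : ℕ,
              (2 - (2 : ℂ) ^ (1 - 2 * ((n : ℤ) + 1))) * Complex.Gamma (2 * ((n : ℂ) + 1)) *
                riemannZeta (2 * ((n : ℂ) + 1)) / Complex.Gamma (2 * ((n : ℂ) + 1) + 6)) := by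
  have h := hasSum_integral_log_cos.mul_left (1 / 24)
  rw [integral_one_sub_pow_four_mul_log_cos, integral_pow_four_mul_log_sin] at h
  have hC := Complex.hasSum_ofReal.2 h
  simp only [← gamma_zeta_term] at hC
  refine ⟨hC.summable, ?_⟩
  rw [hC.tsum_eq]
  have h3 := riemannZeta_natCast_eq_realZeta (k := 3) (by norm_num)
  have h5 := riemannZeta_natCast_eq_realZeta (k := 5) (by norm_num)
  push_cast at h3 h5 ⊢
  rw [h3, h5]
  have hpi : (π : ℂ) ≠ 0 := by exact_mod_cast Real.pi_ne_zero
  field_simp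
  ring
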